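/- Let T > 0, θ ∈ (0,1], ℓ > 0, c > 0, let E and F be real Banach spaces, and let g : [0,T] × E → F be continuous with g(t,0) = 0 for all t ∈ [0,T] and ‖g(t,v) − g(t,w)‖_F ≤ c(‖v‖_E^ℓ + ‖w‖_E^ℓ)‖v − w‖_E for all t ∈ [0,T] and v, w ∈ E. For u ∈ C_θ((0,T],E) define f(u)(t) := g(t, u(t)) for t ∈ (0,T]. Then for every u ∈ C_θ((0,T],E) the function f(u) belongs to C_{θ(ℓ+1)}((0,T],F), and for all u, w ∈ C_θ((0,T],E) one has ‖f(u) − f(w)‖_{C_{θ(ℓ+1)}((0,T],F)} ≤ c(‖u‖_{C_θ((0,T],E)}^ℓ + ‖w‖_{C_θ((0,T],E)}^ℓ)‖u − w‖_{C_θ((0,T],E)}. -/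

import Mathlib

/-- `u` belongs to the time-weighted space `C_θ((0,T],E)`: it is continuous on `(0,T]`
and `t^θ‖u(t)‖ → 0` as `t → 0⁺`. -/
def memC {E : Type*} [NormedAddCommGroup E] (θ T : ℝ) (u : ℝ → E) : Prop :=
  ContinuousOn u (Set.Ioc 0 T) ∧
    Filter.Tendsto (fun t => t ^ θ * ‖u t‖) (nhdsWithin 0 (Set.Ioi 0)) (nhds 0)

/-- The norm of the time-weighted space `C_θ((0,T],E)`:
`‖u‖ = sup_{t ∈ (0,T]} t^θ‖u(t)‖`. -/
noncomputable def wnorm {E : Type*} [NormedAddCommGroup E] (θ T : ℝ) (u : ℝ → E) : ℝ :=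
  sSup ((fun t => t ^ θ * ‖u t‖) '' Set.Ioc 0 T)

theorem memC.bddAbove {E : Type*} [NormedAddCommGroup E] {θ T : ℝ} {u : ℝ → E}
    (hu : memC θ T u) : BddAbove ((fun t => t ^ θ * ‖u t‖) '' Set.Ioc 0 T) := by
  obtain ⟨δ, hδ, hsmall⟩ := mem_nhdsGT_iff_exists_Ioo_subset.1
    (hu.2.eventually (gt_mem_nhds one_pos))
  have hsub : Set.Icc δ T ⊆ Set.Ioc 0 T := fun t ht => ⟨lt_of_lt_of_le hδ ht.1, ht.2⟩
  have hcont : ContinuousOn (fun t => t ^ θ * ‖u t‖) (Set.Icc δ T) :=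
    (continuousOn_id.rpow_const fun t ht => Or.inl (hsub ht).1.ne').mul (hu.1.mono hsub).norm
  obtain ⟨M, hM⟩ := isCompact_Icc.bddAbove_image hcont
  refine ⟨max 1 M, ?_⟩
  rintro _ ⟨t, ht, rfl⟩
  rcases lt_or_ge t δ with h | h
  · exact le_max_of_le_left (le_of_lt (hsmall ⟨ht.1, h⟩))
  · exact le_max_of_le_right (hM ⟨t, ⟨h, ht.2⟩, rfl⟩)

theorem memC.le_wnorm {E : Type*} [NormedAddCommGroup E] {θ T : ℝ} {u : ℝ → E}
    (hu : memC θ T u) {t : ℝ} (ht : t ∈ Set.Ioc 0 T) : t ^ θ * ‖u t‖ ≤ wnorm θ T u :=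
  le_csSup hu.bddAbove ⟨t, ht, rfl⟩

theorem memC.sub {E : Type*} [NormedAddCommGroup E] {θ T : ℝ} {u w : ℝ → E}
    (hu : memC θ T u) (hw : memC θ T w) : memC θ T (fun t => u t - w t) := by
  refine ⟨hu.1.sub hw.1, ?_⟩
  have hlim := hu.2.add hw.2
  rw [add_zero] at hlim
  refine squeeze_zero' ?_ ?_ hlim
  · filter_upwards [self_mem_nhdsWithin] with t ht
    exact mul_nonneg (Real.rpow_nonneg (le_of_lt ht) _) (norm_nonneg _)
  · filter_upwards [self_mem_nhdsWithin] with t ht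
    rw [← mul_add]
    exact mul_le_mul_of_nonneg_left (norm_sub_le _ _) (Real.rpow_nonneg (le_of_lt ht) _)

/-- Distributes the weight `t^(θ(ℓ+1))` over the factors of a bound of order `ℓ + 1`. -/
theorem rpow_mul_le_of_le_mul_rpow_add_rpow {t θ ℓ c a b d x : ℝ} (ht : 0 < t)
    (ha : 0 ≤ a) (hb : 0 ≤ b) (hx : x ≤ c * (a ^ ℓ + b ^ ℓ) * d) :
    t ^ (θ * (ℓ + 1)) * x ≤
      c * ((t ^ θ * a) ^ ℓ + (t ^ θ * b) ^ ℓ) * (t ^ θ * d) := by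
  have hθ : 0 ≤ t ^ θ := Real.rpow_nonneg ht.le _
  refine (mul_le_mul_of_nonneg_left hx (Real.rpow_nonneg ht.le _)).trans_eq ?_
  rw [Real.mul_rpow hθ ha, Real.mul_rpow hθ hb, mul_add, mul_one, Real.rpow_add ht,
    Real.rpow_mul ht.le]
  ring

/-- Proposition 7.1: if `g : [0,T] × E → F` is continuous with `g(t,0) = 0` and
`‖g(t,v) − g(t,w)‖ ≤ c(‖v‖^ℓ + ‖w‖^ℓ)‖v − w‖`, then the substitution operator
`f(u)(t) = g(t,u(t))` maps `C_θ((0,T],E)` into `C_{θ(ℓ+1)}((0,T],F)` and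
`‖f(u) − f(w)‖_{C_{θ(ℓ+1)}} ≤ c(‖u‖_{C_θ}^ℓ + ‖w‖_{C_θ}^ℓ)‖u − w‖_{C_θ}`. -/
theorem stmt_1 {E F : Type*} [NormedAddCommGroup E] [NormedSpace ℝ E]
    [NormedAddCommGroup F] [NormedSpace ℝ F] [CompleteSpace E] [CompleteSpace F]
    (T θ ℓ c : ℝ) (hT : 0 < T) (hθ : 0 < θ) (hθ1 : θ ≤ 1) (hℓ : 0 < ℓ) (hc : 0 < c)
    (g : ℝ → E → F)
    (hgc : ContinuousOn (fun p : ℝ × E => g p.1 p.2) (Set.Icc 0 T ×ˢ Set.univ))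
    (hg0 : ∀ t ∈ Set.Icc (0:ℝ) T, g t 0 = 0)
    (hglip : ∀ t ∈ Set.Icc (0:ℝ) T, ∀ v w : E,
      ‖g t v - g t w‖ ≤ c * (‖v‖ ^ ℓ + ‖w‖ ^ ℓ) * ‖v - w‖) :
    (∀ u : ℝ → E, memC θ T u → memC (θ * (ℓ + 1)) T (fun t => g t (u t))) ∧
    (∀ u w : ℝ → E, memC θ T u → memC θ T w →
      wnorm (θ * (ℓ + 1)) T (fun t => g t (u t) - g t (w t)) ≤
        c * (wnorm θ T u ^ ℓ + wnorm θ T w ^ ℓ) * wnorm θ T (fun t => u t - w t)) := by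
  refine ⟨fun u hu => ⟨?_, ?_⟩, fun u w hu hw => ?_⟩
  · exact hgc.comp (continuousOn_id.prodMk hu.1)
      fun t ht => ⟨Set.Ioc_subset_Icc_self ht, Set.mem_univ _⟩
  · have hlim : Filter.Tendsto
        (fun t => c * ((t ^ θ * ‖u t‖) ^ ℓ + (t ^ θ * 0) ^ ℓ) * (t ^ θ * ‖u t‖))
        (nhdsWithin 0 (Set.Ioi 0)) (nhds 0) := by
      have h := ((hu.2.rpow_const (Or.inr hℓ.le)).const_mul c).mul hu.2
      simpa [Real.zero_rpow hℓ.ne'] using h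
    refine squeeze_zero' ?_ ?_ hlim
    · filter_upwards [self_mem_nhdsWithin] with t ht
      exact mul_nonneg (Real.rpow_nonneg (le_of_lt ht) _) (norm_nonneg _)
    · filter_upwards [Ioc_mem_nhdsGT hT] with t ht
      have ht' := Set.Ioc_subset_Icc_self ht
      have h := hglip t ht' (u t) 0
      rw [hg0 t ht', sub_zero, sub_zero, norm_zero] at h
      exact rpow_mul_le_of_le_mul_rpow_add_rpow ht.1 (norm_nonneg _) le_rfl h
  · refine csSup_le ((Set.nonempty_Ioc.2 hT).image _) ?_
    rintro _ ⟨t, ht, rfl⟩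
    have htθ : 0 ≤ t ^ θ := Real.rpow_nonneg ht.1.le _
    refine (rpow_mul_le_of_le_mul_rpow_add_rpow ht.1 (norm_nonneg _) (norm_nonneg _)
      (hglip t (Set.Ioc_subset_Icc_self ht) (u t) (w t))).trans ?_
    have hu' := hu.le_wnorm ht
    have hw' := hw.le_wnorm ht
    have hd' := (hu.sub hw).le_wnorm ht
    have hu0 : 0 ≤ wnorm θ T u := (mul_nonneg htθ (norm_nonneg _)).trans hu'
    have hw0 : 0 ≤ wnorm θ T w := (mul_nonneg htθ (norm_nonneg _)).trans hw'
    gcongr
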